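/- arXiv:1603.06077 — 7 statements merged into one kernel-verified Lean document; each statement's English description precedes it below -/
import Mathlib

section
/- Let S be a finite set of pairwise distinct lines in the plane ℝ², each parallel to one of three fixed, pairwise distinct directions, with x ≥ y ≥ z > 0 lines in the three respective directions, and suppose no point of ℝ² lies on three or more lines of S. Then τ(S) = x if x ≥ y + z, and τ(S) = ⌈(x+y+z)/2⌉ if x < y + z; equivalently, τ(S) = OPT₂(x, y, z). -/
open scoped Classical

/-- `OPT2 x y z = x` if `x ≥ y + z`, else `⌈(x+y+z)/2⌉`. -/
def OPT2 (x y z : ℕ) : ℕ := if y + z ≤ x then x else (x + y + z + 1) / 2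

theorem aux_det (d e : ℝ × ℝ) (hd : d ≠ 0) (h : ∀ c : ℝ, e ≠ c • d) :
    d.1 * e.2 - d.2 * e.1 ≠ 0 := by
  intro h0
  obtain ⟨d1, d2⟩ := d
  obtain ⟨e1, e2⟩ := e
  simp only at h0
  by_cases h1 : d1 = 0
  · subst h1
    have h2 : d2 ≠ 0 := by
      rintro rfl
      exact hd rfl
    apply h (e2 / d2)
    have : e1 = 0 := by
      have : d2 * e1 = 0 := by linarith
      simpa [h2] using this
    ext
    · simp [this]
    · simp [h2]
  · apply h (e1 / d1)
    ext
    · simp [h1]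
    · simp only [Prod.smul_mk, smul_eq_mul]
      field_simp
      linarith

theorem aux_cross (d e : ℝ × ℝ) (hd : d ≠ 0) (h : ∀ c : ℝ, e ≠ c • d)
    (S T : Finset (Set (ℝ × ℝ)))
    (hS : ∀ L ∈ S, ∃ a : ℝ × ℝ, L = {p : ℝ × ℝ | ∃ t : ℝ, p = a + t • d})
    (hT : ∀ L ∈ T, ∃ a : ℝ × ℝ, L = {p : ℝ × ℝ | ∃ t : ℝ, p = a + t • e}) :
    ∀ a ∈ S, ∀ b ∈ T, ∃ p, p ∈ a ∧ p ∈ b := by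
  intro a ha b hb
  obtain ⟨a, rfl⟩ := hS a ha
  obtain ⟨b, rfl⟩ := hT b hb
  have hD := aux_det d e hd h
  set D := d.1 * e.2 - d.2 * e.1 with hDdef
  set t := ((b.1 - a.1) * e.2 - (b.2 - a.2) * e.1) / D with ht
  set s := ((b.1 - a.1) * d.2 - (b.2 - a.2) * d.1) / D with hs
  have ht' : t * D = (b.1 - a.1) * e.2 - (b.2 - a.2) * e.1 := by rw [ht]; field_simp
  have hs' : s * D = (b.1 - a.1) * d.2 - (b.2 - a.2) * d.1 := by rw [hs]; field_simp
  refine ⟨a + t • d, ⟨t, rfl⟩, s, ?_⟩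
  ext
  · simp only [Prod.fst_add, Prod.smul_fst, smul_eq_mul]
    apply mul_right_cancel₀ hD
    linear_combination d.1 * ht' - e.1 * hs' + (b.1 - a.1) * hDdef
  · simp only [Prod.snd_add, Prod.smul_snd, smul_eq_mul]
    apply mul_right_cancel₀ hD
    linear_combination d.2 * ht' - e.2 * hs' + (b.2 - a.2) * hDdef

def AuxCross (A B : Finset (Set (ℝ × ℝ))) : Prop := ∀ a ∈ A, ∀ b ∈ B, ∃ p, p ∈ a ∧ p ∈ b

theorem AuxCross.swap {A B : Finset (Set (ℝ × ℝ))} (h : AuxCross A B) : AuxCross B A := by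
  intro a ha b hb
  obtain ⟨p, h1, h2⟩ := h b hb a ha
  exact ⟨p, h2, h1⟩

def AuxP (n : ℕ) (A B C : Finset (Set (ℝ × ℝ))) : Prop :=
  A.card ≤ n → B.card ≤ n → C.card ≤ n → A.card + B.card + C.card ≤ 2 * n →
  AuxCross A B → AuxCross A C → AuxCross B C →
  (∀ a ∈ A, a.Nonempty) → (∀ a ∈ B, a.Nonempty) → (∀ a ∈ C, a.Nonempty) →
  ∃ H : Finset (ℝ × ℝ), (∀ L ∈ A ∪ B ∪ C, ∃ p ∈ H, p ∈ L) ∧ H.card ≤ n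

theorem aux_step (n : ℕ) (ih : ∀ A B C, AuxP n A B C) (A B C : Finset (Set (ℝ × ℝ)))
    (hAB : B.card ≤ A.card) (hBC : C.card ≤ B.card) : AuxP (n + 1) A B C := by
  intro hA hB hC hs cAB cAC cBC nA nB nC
  rcases A.eq_empty_or_nonempty with rfl | ⟨a, ha⟩
  · have hB0 : B = ∅ := by simpa using hAB
    subst hB0
    have hC0 : C = ∅ := by simpa using hBC
    subst hC0
    exact ⟨∅, by simp, by simp⟩
  have eA := Finset.card_erase_of_mem ha
  have pA := Finset.card_pos.2 ⟨a, ha⟩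
  have key : ∃ p, p ∈ a ∧ ∃ B' ⊆ B, (∀ b ∈ B, b ∈ B' ∨ p ∈ b) ∧
      B'.card = B.card - 1 := by
    rcases B.eq_empty_or_nonempty with rfl | ⟨b, hb⟩
    · obtain ⟨p, hp⟩ := nA a ha
      exact ⟨p, hp, ∅, by simp, by simp, by simp⟩
    · obtain ⟨p, hp, hq⟩ := cAB a ha b hb
      refine ⟨p, hp, B.erase b, Finset.erase_subset _ _, ?_, Finset.card_erase_of_mem hb⟩
      intro c hc
      by_cases h : c = b
      · right; rw [h]; exact hq
      · left; simp [h, hc]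
  obtain ⟨p, hp, B', hB', hcov, hcard⟩ := key
  have sA : ∀ {L}, L ∈ A.erase a → L ∈ A := fun h => Finset.mem_of_mem_erase h
  obtain ⟨H, hH, hHc⟩ := ih (A.erase a) B' C (by omega) (by omega) (by omega) (by omega)
    (fun u hu v hv => cAB u (sA hu) v (hB' hv)) (fun u hu v hv => cAC u (sA hu) v hv)
    (fun u hu v hv => cBC u (hB' hu) v hv) (fun u hu => nA u (sA hu))
    (fun u hu => nB u (hB' hu)) nC
  refine ⟨insert p H, ?_, (Finset.card_insert_le _ _).trans (by omega)⟩
  have lift : ∀ L, (L ∈ A.erase a ∪ B' ∪ C) → ∃ q ∈ insert p H, q ∈ L := by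
    intro L hL
    obtain ⟨q, h1, h2⟩ := hH L hL
    exact ⟨q, Finset.mem_insert_of_mem h1, h2⟩
  intro L hL
  simp only [Finset.mem_union] at hL lift
  rcases hL with (hL | hL) | hL
  · by_cases h : L = a
    · exact ⟨p, Finset.mem_insert_self _ _, h ▸ hp⟩
    · exact lift L (Or.inl (Or.inl (Finset.mem_erase.2 ⟨h, hL⟩)))
  · rcases hcov L hL with h | h
    · exact lift L (Or.inl (Or.inr h))
    · exact ⟨p, Finset.mem_insert_self _ _, h⟩
  · exact lift L (Or.inr hL)

theorem AuxP.s12 {n : ℕ} {A B C : Finset (Set (ℝ × ℝ))} (h : AuxP n B A C) : AuxP n A B C := by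
  intro hA hB hC hs cAB cAC cBC nA nB nC
  rw [Finset.union_comm A B]
  exact h hB hA hC (by omega) cAB.swap cBC cAC nB nA nC

theorem AuxP.s23 {n : ℕ} {A B C : Finset (Set (ℝ × ℝ))} (h : AuxP n A C B) : AuxP n A B C := by
  intro hA hB hC hs cAB cAC cBC nA nB nC
  rw [Finset.union_right_comm]
  exact h hA hC hB (by omega) cAC cAB cBC.swap nA nC nB

theorem auxP_all (n : ℕ) : ∀ A B C, AuxP n A B C := by
  induction n with
  | zero =>
    intro A B C hA hB hC
    intros
    have hA0 : A = ∅ := by simpa using hA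
    have hB0 : B = ∅ := by simpa using hB
    have hC0 : C = ∅ := by simpa using hC
    subst hA0 hB0 hC0
    exact ⟨∅, by simp, by simp⟩
  | succ n ih =>
    intro A B C
    have st := aux_step n ih
    rcases le_total A.card B.card with h1 | h1 <;> rcases le_total B.card C.card with h2 | h2 <;>
      rcases le_total A.card C.card with h3 | h3
    · exact (st C B A h2 h1).s12.s23.s12
    · exact (st C B A h2 h1).s12.s23.s12
    · exact (st B C A h2 h3).s23.s12
    · exact (st B A C h1 h3).s12
    · exact (st C A B h3 h1).s12.s23
    · exact (st A C B h3 h2).s23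
    · exact (st A B C h1 h2)
    · exact (st A B C h1 h2)

theorem aux_lower (S : Finset (Set (ℝ × ℝ))) (H : Finset (ℝ × ℝ)) (k : ℕ)
    (hH : ∀ L ∈ S, ∃ p ∈ H, p ∈ L) (hk : ∀ p, (S.filter (fun L => p ∈ L)).card ≤ k) :
    S.card ≤ H.card * k := by
  refine (Finset.card_le_card (t := H.biUnion (fun p => S.filter (fun L => p ∈ L))) ?_).trans
    (Finset.card_biUnion_le_card_mul _ _ _ (fun p _ => hk p))
  intro L hL
  obtain ⟨p, h1, h2⟩ := hH L hL
  exact Finset.mem_biUnion.2 ⟨p, h1, Finset.mem_filter.2 ⟨hL, h2⟩⟩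

theorem aux_par (d : ℝ × ℝ) (S : Finset (Set (ℝ × ℝ)))
    (hS : ∀ L ∈ S, ∃ a : ℝ × ℝ, L = {p : ℝ × ℝ | ∃ t : ℝ, p = a + t • d}) (p : ℝ × ℝ) :
    (S.filter (fun L => p ∈ L)).card ≤ 1 := by
  have key : ∀ L ∈ S, p ∈ L → L = {q : ℝ × ℝ | ∃ t : ℝ, q = p + t • d} := by
    intro L hL hp
    obtain ⟨a, rfl⟩ := hS L hL
    obtain ⟨t, rfl⟩ := hp
    ext q
    constructor
    · rintro ⟨s, rfl⟩
      exact ⟨s - t, by module⟩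
    · rintro ⟨s, rfl⟩
      exact ⟨t + s, by module⟩
  rw [Finset.card_le_one]
  intro a ha b hb
  rw [Finset.mem_filter] at ha hb
  rw [key a ha.1 ha.2, key b hb.1 hb.2]

theorem aux_ne (d : ℝ × ℝ) (S : Finset (Set (ℝ × ℝ)))
    (hS : ∀ L ∈ S, ∃ a : ℝ × ℝ, L = {p : ℝ × ℝ | ∃ t : ℝ, p = a + t • d}) :
    ∀ L ∈ S, L.Nonempty := by
  intro L hL
  obtain ⟨a, rfl⟩ := hS L hL
  exact ⟨a, 0, by simp⟩

/-- For lines of three distinct slopes with no point on three or more lines,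
the minimum hitting set size is `OPT2 x y z`. -/
theorem stmt_2 (d₁ d₂ d₃ : ℝ × ℝ) (hd₁ : d₁ ≠ 0) (hd₂ : d₂ ≠ 0) (hd₃ : d₃ ≠ 0)
    (h12 : ∀ c : ℝ, d₂ ≠ c • d₁) (h13 : ∀ c : ℝ, d₃ ≠ c • d₁) (h23 : ∀ c : ℝ, d₃ ≠ c • d₂)
    (S₁ S₂ S₃ : Finset (Set (ℝ × ℝ)))
    (hS₁ : ∀ L ∈ S₁, ∃ a : ℝ × ℝ, L = {p : ℝ × ℝ | ∃ t : ℝ, p = a + t • d₁})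
    (hS₂ : ∀ L ∈ S₂, ∃ a : ℝ × ℝ, L = {p : ℝ × ℝ | ∃ t : ℝ, p = a + t • d₂})
    (hS₃ : ∀ L ∈ S₃, ∃ a : ℝ × ℝ, L = {p : ℝ × ℝ | ∃ t : ℝ, p = a + t • d₃})
    (h12' : Disjoint S₁ S₂) (h13' : Disjoint S₁ S₃) (h23' : Disjoint S₂ S₃)
    (x y z : ℕ) (hx : S₁.card = x) (hy : S₂.card = y) (hz : S₃.card = z)
    (hxy : y ≤ x) (hyz : z ≤ y) (hz0 : 0 < z)
    (htriple : ∀ p : ℝ × ℝ, ((S₁ ∪ S₂ ∪ S₃).filter (fun L => p ∈ L)).card ≤ 2) :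
    IsLeast {n : ℕ | ∃ H : Finset (ℝ × ℝ),
      (∀ L ∈ S₁ ∪ S₂ ∪ S₃, ∃ p ∈ H, p ∈ L) ∧ H.card = n} (OPT2 x y z) := by
  have hlow : ∀ H : Finset (ℝ × ℝ), (∀ L ∈ S₁ ∪ S₂ ∪ S₃, ∃ p ∈ H, p ∈ L) →
      OPT2 x y z ≤ H.card := by
    intro H hH
    have l1 := aux_lower S₁ H 1 (fun L hL => hH L (by simp [hL])) (aux_par d₁ S₁ hS₁)
    have l2 := aux_lower _ H 2 hH htriple
    rw [Finset.card_union_of_disjoint (Finset.disjoint_union_left.2 ⟨h13', h23'⟩),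
      Finset.card_union_of_disjoint h12'] at l2
    unfold OPT2
    split_ifs <;> omega
  constructor
  · have hx' : x ≤ OPT2 x y z := by unfold OPT2; split_ifs <;> omega
    have hs' : x + y + z ≤ 2 * OPT2 x y z := by unfold OPT2; split_ifs <;> omega
    obtain ⟨H, hH, hc⟩ := auxP_all (OPT2 x y z) S₁ S₂ S₃ (by omega) (by omega) (by omega)
      (by omega) (aux_cross d₁ d₂ hd₁ h12 S₁ S₂ hS₁ hS₂) (aux_cross d₁ d₃ hd₁ h13 S₁ S₃ hS₁ hS₃)
      (aux_cross d₂ d₃ hd₂ h23 S₂ S₃ hS₂ hS₃) (aux_ne d₁ S₁ hS₁) (aux_ne d₂ S₂ hS₂)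
      (aux_ne d₃ S₃ hS₃)
    exact ⟨H, hH, le_antisymm hc (hlow H hH)⟩
  · rintro n ⟨H, hH, rfl⟩
    exact hlow H hH
end

section
/- Let x ≥ y ≥ z ≥ 0 be integers with x ≤ y + z, and let A, B, C be pairwise disjoint finite sets with |A| = x, |B| = y, |C| = z. Then A ∪ B ∪ C can be partitioned into ⌊(x+y+z)/2⌋ two-element blocks, each consisting of two elements taken from two different sets among A, B, C, together with exactly one singleton block if x + y + z is odd (and no singleton block if x + y + z is even). -/
def Good3 {α : Type*} [DecidableEq α] (A B C : Finset α) : Prop :=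
    ∃ P : Finset (Finset α),
      ((P : Set (Finset α)).PairwiseDisjoint id) ∧
      P.biUnion id = A ∪ B ∪ C ∧
      (∀ b ∈ P,
        (∃ p q, p ≠ q ∧ b = {p, q} ∧
          ¬(p ∈ A ∧ q ∈ A) ∧ ¬(p ∈ B ∧ q ∈ B) ∧ ¬(p ∈ C ∧ q ∈ C)) ∨ b.card = 1) ∧
      (P.filter (fun b => b.card = 2)).card = (A.card + B.card + C.card) / 2 ∧
      (P.filter (fun b => b.card = 1)).card = (A.card + B.card + C.card) % 2

theorem Good3.swap12 {α : Type*} [DecidableEq α] {A B C : Finset α} (h : Good3 A B C) :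
    Good3 B A C := by
  obtain ⟨P, h1, h2, h3, h4, h5⟩ := h
  refine ⟨P, h1, ?_, ?_, ?_, ?_⟩
  · rw [h2, Finset.union_comm A B]
  · intro b hb
    rcases h3 b hb with ⟨p, q, h, h', ha, hb, hc⟩ | h
    · exact Or.inl ⟨p, q, h, h', hb, ha, hc⟩
    · exact Or.inr h
  · rw [h4, add_comm A.card]
  · rw [h5, add_comm A.card]

theorem Good3.swap23 {α : Type*} [DecidableEq α] {A B C : Finset α} (h : Good3 A B C) :
    Good3 A C B := by
  obtain ⟨P, h1, h2, h3, h4, h5⟩ := h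
  refine ⟨P, h1, ?_, ?_, ?_, ?_⟩
  · rw [h2, Finset.union_right_comm]
  · intro b hb
    rcases h3 b hb with ⟨p, q, h, h', ha, hb, hc⟩ | h
    · exact Or.inl ⟨p, q, h, h', ha, hc, hb⟩
    · exact Or.inr h
  · rw [h4, add_right_comm]
  · rw [h5, add_right_comm]

theorem Good3.step {α : Type*} [DecidableEq α] {A B C : Finset α}
    (hAB : Disjoint A B) (hAC : Disjoint A C) (hBC : Disjoint B C) {p q : α}
    (hp : p ∈ A) (hq : q ∈ B) (h : Good3 (A.erase p) (B.erase q) C) : Good3 A B C := by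
  obtain ⟨P, h1, h2, h3, h4, h5⟩ := h
  rw [Finset.disjoint_left] at hAB hAC hBC
  have hpq : p ≠ q := by rintro rfl; exact hAB hp hq
  have hsub : ∀ b ∈ P, ∀ t ∈ b, t ∈ A.erase p ∪ B.erase q ∪ C := by
    intro b hb t ht
    rw [← h2]
    exact Finset.mem_biUnion.2 ⟨b, hb, ht⟩
  have hpn : ∀ b ∈ P, p ∉ b := by
    intro b hb ht
    have := hsub b hb p ht
    grind
  have hqn : ∀ b ∈ P, q ∉ b := by
    intro b hb ht
    have := hsub b hb q ht
    grind
  have hnot : ({p, q} : Finset α) ∉ P := fun h => hpn _ h (by simp)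
  have hcard : ({p, q} : Finset α).card = 2 := Finset.card_pair hpq
  have ha := Finset.card_erase_add_one hp
  have hb := Finset.card_erase_add_one hq
  refine ⟨insert {p, q} P, ?_, ?_, ?_, ?_, ?_⟩
  · rw [Finset.coe_insert]
    refine h1.insert ?_
    intro b hb _
    simp only [id]
    rw [Finset.disjoint_left]
    intro t ht ht'
    have := hpn b hb
    have := hqn b hb
    grind
  · rw [Finset.biUnion_insert, h2]
    ext t
    simp only [id, Finset.mem_union, Finset.mem_erase, Finset.mem_insert, Finset.mem_singleton]
    grind
  · intro b hb
    rcases Finset.mem_insert.1 hb with rfl | hb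
    · exact Or.inl ⟨p, q, hpq, rfl, by grind, by grind, by grind⟩
    · rcases h3 b hb with ⟨r, s, h, h', hA, hB, hC⟩ | h
      · have := hpn b hb
        have := hqn b hb
        subst h'
        exact Or.inl ⟨r, s, h, rfl, by grind, by grind, hC⟩
      · exact Or.inr h
  · rw [Finset.filter_insert, if_pos hcard, Finset.card_insert_of_notMem (by simp [hnot]), h4]
    omega
  · rw [Finset.filter_insert, if_neg (by omega), h5]
    omega

theorem Good3.base {α : Type*} [DecidableEq α] {A B C : Finset α}
    (h : A.card + B.card + C.card ≤ 1) : Good3 A B C := by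
  have key : ∀ {A B C : Finset α}, A.card ≤ 1 → B.card = 0 → C.card = 0 → Good3 A B C := by
    intro A B C ha hb hc
    obtain rfl := Finset.card_eq_zero.1 hb
    obtain rfl := Finset.card_eq_zero.1 hc
    rcases Nat.le_one_iff_eq_zero_or_eq_one.1 ha with h | h
    · obtain rfl := Finset.card_eq_zero.1 h
      exact ⟨∅, by simp⟩
    · obtain ⟨a, rfl⟩ := Finset.card_eq_one.1 h
      refine ⟨{{a}}, by simp, by simp, by simp, ?_, ?_⟩ <;> simp [Finset.filter_singleton]
  by_cases hb : B.card = 0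
  · by_cases hc : C.card = 0
    · exact key (by omega) hb hc
    · exact (key (A := C) (B := A) (C := B) (by omega) (by omega) (by omega)).swap12.swap23
  · exact (key (A := B) (B := A) (C := C) (by omega) (by omega) (by omega)).swap12

theorem Good3.main {α : Type*} [DecidableEq α] (n : ℕ) : ∀ A B C : Finset α,
    Disjoint A B → Disjoint A C → Disjoint B C → A.card + B.card + C.card = n →
    A.card ≤ B.card + C.card + 1 → B.card ≤ A.card + C.card + 1 → C.card ≤ A.card + B.card + 1 →
    Good3 A B C := by
  induction n using Nat.strong_induction_on with
  | _ n ih =>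
  have key : ∀ A B C : Finset α,
      Disjoint A B → Disjoint A C → Disjoint B C → A.card + B.card + C.card = n →
      A.card ≤ B.card + C.card + 1 → C.card ≤ B.card → C.card ≤ A.card → B.card ≤ A.card + C.card + 1 →
      Good3 A B C := by
    intro A B C hAB hAC hBC hn h1 h2 h3 h4
    by_cases hs : A.card + B.card + C.card ≤ 1
    · exact Good3.base hs
    obtain ⟨p, hp⟩ := Finset.card_pos.1 (show 0 < A.card by omega)
    obtain ⟨q, hq⟩ := Finset.card_pos.1 (show 0 < B.card by omega)
    have ha := Finset.card_erase_add_one hp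
    have hb := Finset.card_erase_add_one hq
    refine Good3.step hAB hAC hBC hp hq (ih (n - 2) (by omega) _ _ _ ?_ ?_ ?_ ?_ ?_ ?_ ?_)
    · exact hAB.mono (Finset.erase_subset _ _) (Finset.erase_subset _ _)
    · exact hAC.mono_left (Finset.erase_subset _ _)
    · exact hBC.mono_left (Finset.erase_subset _ _)
    all_goals omega
  intro A B C hAB hAC hBC hn h1 h2 h3
  by_cases hc : C.card ≤ B.card ∧ C.card ≤ A.card
  · exact key A B C hAB hAC hBC hn h1 hc.1 hc.2 h2
  by_cases hb : B.card ≤ C.card ∧ B.card ≤ A.card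
  · exact (key A C B hAC hAB hBC.symm (by omega) (by omega) hb.1 hb.2 (by omega)).swap23
  · exact (key B C A hBC hAB.symm hAC.symm (by omega) (by omega) (by omega) (by omega)
      (by omega)).swap23.swap12


/-- If `x ≥ y ≥ z ≥ 0`, `x ≤ y + z`, and `A, B, C` are pairwise disjoint finite sets
with these cardinalities, then `A ∪ B ∪ C` can be partitioned into `⌊(x+y+z)/2⌋`
two-element blocks, each with its two elements from two different sets among
`A, B, C`, plus exactly one singleton block iff `x + y + z` is odd. -/
theorem stmt_3 {α : Type*} [DecidableEq α] (x y z : ℕ) (hxy : y ≤ x) (hyz : z ≤ y)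
    (hle : x ≤ y + z) (A B C : Finset α)
    (hAB : Disjoint A B) (hAC : Disjoint A C) (hBC : Disjoint B C)
    (hA : A.card = x) (hB : B.card = y) (hC : C.card = z) :
    ∃ P : Finset (Finset α),
      ((P : Set (Finset α)).PairwiseDisjoint id) ∧
      P.biUnion id = A ∪ B ∪ C ∧
      (∀ b ∈ P,
        (∃ p q, p ≠ q ∧ b = {p, q} ∧
          ¬(p ∈ A ∧ q ∈ A) ∧ ¬(p ∈ B ∧ q ∈ B) ∧ ¬(p ∈ C ∧ q ∈ C)) ∨ b.card = 1) ∧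
      (P.filter (fun b => b.card = 2)).card = (x + y + z) / 2 ∧
      (P.filter (fun b => b.card = 1)).card = (x + y + z) % 2 := by
  subst hA hB hC
  exact Good3.main _ A B C hAB hAC hBC rfl (by omega) (by omega) (by omega)
end

section
/- Let G be a finite simple graph and let 𝒞 be a family of cliques of G such that every edge of G is contained in at least one clique of 𝒞 and every vertex of G belongs to at most 3 cliques of 𝒞. If M is a maximal independent set of G and I is any independent set of G, then |I| ≤ 3·|M|. -/
open scoped Classical

/-- If the edges of `G` are covered by cliques, with each vertex in at most 3 cliques,
then any independent set is at most 3 times as large as any maximal independent set. -/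
theorem stmt_5 {V : Type*} [Fintype V] (G : SimpleGraph V)
    (𝒞 : Finset (Finset V))
    (hclique : ∀ c ∈ 𝒞, G.IsClique (c : Set V))
    (hedge : ∀ u v : V, G.Adj u v → ∃ c ∈ 𝒞, u ∈ c ∧ v ∈ c)
    (hdeg : ∀ v : V, (𝒞.filter (fun c => v ∈ c)).card ≤ 3)
    (M I : Finset V)
    (hMind : ∀ u ∈ M, ∀ v ∈ M, ¬G.Adj u v)
    (hMmax : ∀ v : V, v ∉ M → ∃ u ∈ M, G.Adj u v)
    (hIind : ∀ u ∈ I, ∀ v ∈ I, ¬G.Adj u v) :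
    I.card ≤ 3 * M.card := by
  have h1 : ∀ v : V, ∃ u ∈ M, u = v ∨ G.Adj u v := by
    intro v
    by_cases hv : v ∈ M
    · exact ⟨v, hv, Or.inl rfl⟩
    · obtain ⟨u, hu, h⟩ := hMmax v hv
      exact ⟨u, hu, Or.inr h⟩
  choose f hfM hf using h1
  refine Finset.card_le_mul_card_image_of_maps_to (f := f) (fun a _ => hfM a) 3 ?_
  intro u _
  by_cases huI : u ∈ I
  · have hs : (I.filter (fun a => f a = u)) ⊆ {u} := by
      intro a ha
      rw [Finset.mem_filter] at ha
      obtain ⟨haI, rfl⟩ := ha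
      rcases hf a with h | h
      · exact Finset.mem_singleton.2 h.symm
      · exact absurd h (hIind _ huI _ haI)
    have := Finset.card_le_card hs
    rw [Finset.card_singleton] at this
    omega
  · have hadj : ∀ a ∈ I.filter (fun a => f a = u), ∃ c ∈ 𝒞, u ∈ c ∧ a ∈ c := by
      intro a ha
      rw [Finset.mem_filter] at ha
      obtain ⟨haI, rfl⟩ := ha
      rcases hf a with h | h
      · rw [h] at huI
        exact absurd haI huI
      · exact hedge _ _ h
    choose! g hgC hgu hga using hadj
    refine le_trans (Finset.card_le_card_of_injOn g ?_ ?_) (hdeg u)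
    · intro a ha
      exact Finset.mem_coe.2 (Finset.mem_filter.2 ⟨hgC a ha, hgu a ha⟩)
    · intro a ha b hb hab
      by_contra hne
      have hb' := hga b hb
      rw [← hab] at hb'
      exact hIind a (Finset.mem_filter.1 ha).1 b (Finset.mem_filter.1 hb).1
        (hclique _ (hgC a ha) (hga a ha) hb' hne)
end

section
/- Let P be a finite set, let I be a finite index set, and for each i ∈ I let H_i ⊆ P and V_i ⊆ P. Let x : P → ℝ satisfy 0 ≤ x(p) ≤ 1 for all p ∈ P and Σ_{p ∈ H_i} x(p) + Σ_{p ∈ V_i} x(p) ≥ 1 for every i ∈ I. Define y : P → ℝ by y(p) = min(2·x(p), 1). Then: (1) Σ_{p ∈ P} y(p) ≤ 2·Σ_{p ∈ P} x(p); and (2) for every i ∈ I, if Σ_{p ∈ H_i} x(p) ≥ 1/2 then Σ_{p ∈ H_i} y(p) ≥ 1, and otherwise Σ_{p ∈ V_i} y(p) ≥ 1. -/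
/-- LP-rounding lemma behind the 4-approximation for hitting unions of a horizontal
and a vertical segment. -/
theorem stmt_9 {α ι : Type*} (P : Finset α) (I : Finset ι)
    (H V : ι → Finset α) (hH : ∀ i ∈ I, H i ⊆ P) (hV : ∀ i ∈ I, V i ⊆ P)
    (x : α → ℝ) (hx0 : ∀ p ∈ P, 0 ≤ x p) (hx1 : ∀ p ∈ P, x p ≤ 1)
    (hcov : ∀ i ∈ I, 1 ≤ (∑ p ∈ H i, x p) + ∑ p ∈ V i, x p)
    (y : α → ℝ) (hy : ∀ p, y p = min (2 * x p) 1) :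
    (∑ p ∈ P, y p ≤ 2 * ∑ p ∈ P, x p) ∧
    (∀ i ∈ I, ((1 : ℝ) / 2 ≤ ∑ p ∈ H i, x p → 1 ≤ ∑ p ∈ H i, y p) ∧
      ((∑ p ∈ H i, x p) < 1 / 2 → 1 ≤ ∑ p ∈ V i, y p)) := by
  have key : ∀ S : Finset α, S ⊆ P → (1 : ℝ) / 2 ≤ ∑ p ∈ S, x p → 1 ≤ ∑ p ∈ S, y p := by
    intro S hS h
    have hy0 : ∀ p ∈ S, 0 ≤ y p := by
      intro p hp
      rw [hy]
      exact le_min (by linarith [hx0 p (hS hp)]) zero_le_one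
    by_cases hbig : ∃ p ∈ S, 1 ≤ 2 * x p
    · obtain ⟨p, hp, h1⟩ := hbig
      have h2 : y p = 1 := by rw [hy, min_eq_right h1]
      have h3 := Finset.single_le_sum hy0 hp
      linarith
    · push Not at hbig
      have h2 : ∑ p ∈ S, y p = 2 * ∑ p ∈ S, x p := by
        rw [Finset.mul_sum]
        refine Finset.sum_congr rfl fun p hp => ?_
        rw [hy, min_eq_left (hbig p hp).le]
      linarith
  refine ⟨?_, fun i hi => ⟨key _ (hH i hi), fun h => key _ (hV i hi) ?_⟩⟩
  · rw [Finset.mul_sum]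
    refine Finset.sum_le_sum fun p _ => ?_
    rw [hy]
    exact min_le_left _ _
  · linarith [hcov i hi]
end

section
/- Let F be a finite family of nonempty closed bounded intervals of ℝ. Then the minimum cardinality of a finite set P ⊆ ℝ such that every interval of F contains a point of P equals the maximum cardinality of a subfamily of F whose members are pairwise disjoint. -/
theorem stab_weak (F : Finset (Set ℝ)) (P : Finset ℝ) (hP : ∀ s ∈ F, ∃ p ∈ P, p ∈ s)
    (D : Finset (Set ℝ)) (hD : D ⊆ F)
    (hd : (D : Set (Set ℝ)).Pairwise fun s t => s ∩ t = ∅) : D.card ≤ P.card := by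
  choose! f hf hfs using hP
  refine Finset.card_le_card_of_injOn f (fun s hs => hf s (hD hs)) ?_
  intro s hs t ht hst
  by_contra hne
  have h := hd hs ht hne
  have h1 : f s ∈ s ∩ t := ⟨hfs s (hD hs), hst ▸ hfs t (hD ht)⟩
  rw [h] at h1
  exact h1

theorem stab_strong (F : Finset (Set ℝ))
    (hF : ∀ s ∈ F, ∃ a b : ℝ, a ≤ b ∧ s = Set.Icc a b) :
    ∃ (P : Finset ℝ) (D : Finset (Set ℝ)), (∀ s ∈ F, ∃ p ∈ P, p ∈ s) ∧ D ⊆ F ∧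
      ((D : Set (Set ℝ)).Pairwise fun s t => s ∩ t = ∅) ∧ P.card ≤ D.card := by
  classical
  induction F using Finset.strongInduction with
  | H F ih =>
    rcases F.eq_empty_or_nonempty with rfl | hne
    · exact ⟨∅, ∅, by simp⟩
    obtain ⟨s0, hs0, hmin⟩ := F.exists_min_image sSup hne
    obtain ⟨a, b, hab, rfl⟩ := hF s0 hs0
    rw [csSup_Icc hab] at hmin
    have hb : b ∈ Set.Icc a b := ⟨hab, le_rfl⟩
    obtain ⟨P, D, h1, h2, h3, h4⟩ := ih (F.filter fun s => b ∉ s)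
      (Finset.filter_ssubset.2 ⟨_, hs0, by simpa using hab⟩)
      (fun s hs => hF s (Finset.mem_filter.1 hs).1)
    have key : ∀ t ∈ D, Set.Icc a b ∩ t = ∅ := by
      intro t ht
      obtain ⟨htF, hbt⟩ := Finset.mem_filter.1 (h2 ht)
      obtain ⟨c, d, hcd, rfl⟩ := hF t htF
      have hm := hmin _ htF
      rw [csSup_Icc hcd] at hm
      ext x
      simp only [Set.mem_inter_iff, Set.mem_Icc, Set.mem_empty_iff_false, iff_false]
      rintro ⟨⟨_, hx⟩, hx', _⟩
      exact hbt ⟨hx'.trans hx, hm⟩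
    refine ⟨insert b P, insert (Set.Icc a b) D, ?_, ?_, ?_, ?_⟩
    · intro s hs
      by_cases hbs : b ∈ s
      · exact ⟨b, Finset.mem_insert_self _ _, hbs⟩
      · obtain ⟨p, hp, hps⟩ := h1 s (Finset.mem_filter.2 ⟨hs, hbs⟩)
        exact ⟨p, Finset.mem_insert_of_mem hp, hps⟩
    · exact Finset.insert_subset hs0 (h2.trans (Finset.filter_subset _ _))
    · rw [Finset.coe_insert]
      refine h3.insert fun t ht _ => ⟨key t ht, ?_⟩
      rw [Set.inter_comm]; exact key t ht
    · rw [Finset.card_insert_of_notMem (s := D)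
        (fun h => (Finset.mem_filter.1 (h2 h)).2 hb)]
      exact (Finset.card_insert_le _ _).trans (by omega)

/-- Interval stabbing duality: for a finite family of nonempty closed bounded intervals
of `ℝ`, the minimum number of points needed to hit all intervals equals the maximum
number of pairwise disjoint intervals in the family. -/
theorem stmt_11 (F : Finset (Set ℝ))
    (hF : ∀ s ∈ F, ∃ a b : ℝ, a ≤ b ∧ s = Set.Icc a b) :
    ∃ n : ℕ,
      IsLeast {m : ℕ | ∃ P : Finset ℝ, (∀ s ∈ F, ∃ p ∈ P, p ∈ s) ∧ P.card = m} n ∧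
      IsGreatest {m : ℕ | ∃ D : Finset (Set ℝ), D ⊆ F ∧
        ((D : Set (Set ℝ)).Pairwise fun s t => s ∩ t = ∅) ∧ D.card = m} n := by
  obtain ⟨P, D, h1, h2, h3, h4⟩ := stab_strong F hF
  have h5 := stab_weak F P h1 D h2 h3
  refine ⟨P.card, ⟨⟨P, h1, rfl⟩, ?_⟩, ⟨D, h2, h3, le_antisymm h5 h4⟩, ?_⟩
  · rintro m ⟨Q, hQ, rfl⟩
    exact h4.trans (stab_weak F Q hQ D h2 h3)
  · rintro m ⟨E, hE, hE', rfl⟩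
    exact stab_weak F P h1 E hE hE'
end

section
/- Let V be a finite set of pairwise distinct vertical lines in the plane ℝ² and let H be a finite family of nonempty closed horizontal segments in ℝ². For a point p ∈ ℝ², let H_p = {s ∈ H : p ∈ s}. Assume: (a) for every point p lying on some line of V, τ(H \ H_p) = τ(H); and (b) for every two points p, q with equal y-coordinates lying on two distinct lines of V, τ(H \ (H_p ∪ H_q)) = τ(H). Then every hitting set for V ∪ H has cardinality at least |V| + τ(H). -/
open scoped Classical

/-- `tau F` is the minimum cardinality of a finite hitting set for `F`. -/
noncomputable def tau (F : Finset (Set (ℝ × ℝ))) : ℕ :=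
  sInf {n : ℕ | ∃ P : Finset (ℝ × ℝ), (∀ s ∈ F, ∃ p ∈ P, p ∈ s) ∧ P.card = n}

theorem tau_le_aux (F : Finset (Set (ℝ × ℝ))) (P : Finset (ℝ × ℝ))
    (h : ∀ s ∈ F, ∃ p ∈ P, p ∈ s) : tau F ≤ P.card :=
  Nat.sInf_le ⟨P, h, rfl⟩

theorem tau_exists_aux (F : Finset (Set (ℝ × ℝ))) (hF : ∀ s ∈ F, s.Nonempty) :
    ∃ P : Finset (ℝ × ℝ), (∀ s ∈ F, ∃ p ∈ P, p ∈ s) ∧ P.card = tau F := by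
  have : {n : ℕ | ∃ P : Finset (ℝ × ℝ),
      (∀ s ∈ F, ∃ p ∈ P, p ∈ s) ∧ P.card = n}.Nonempty := by
    choose f hf using hF
    refine ⟨_, F.attach.image (fun s => f s.1 s.2), ?_, rfl⟩
    intro s hs
    exact ⟨f s hs, Finset.mem_image.2 ⟨⟨s, hs⟩, Finset.mem_attach _ _, rfl⟩, hf s hs⟩
  exact Nat.sInf_mem this

theorem tau_add_aux (F : Finset (Set (ℝ × ℝ))) (hF : ∀ s ∈ F, s.Nonempty) (R : Set (ℝ × ℝ))
    (hR : ∀ s ∈ F, s ⊆ R ∨ Disjoint s R) :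
    tau F = tau (F.filter (fun s => s ⊆ R)) + tau (F.filter (fun s => ¬ s ⊆ R)) := by
  apply le_antisymm
  · obtain ⟨P, hP, hPc⟩ := tau_exists_aux (F.filter (fun s => s ⊆ R))
      (fun s hs => hF s (Finset.mem_filter.1 hs).1)
    obtain ⟨Q, hQ, hQc⟩ := tau_exists_aux (F.filter (fun s => ¬ s ⊆ R))
      (fun s hs => hF s (Finset.mem_filter.1 hs).1)
    rw [← hPc, ← hQc]
    refine (tau_le_aux F (P ∪ Q) ?_).trans (Finset.card_union_le _ _)
    intro s hs
    by_cases h : s ⊆ R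
    · obtain ⟨p, hp, hps⟩ := hP s (Finset.mem_filter.2 ⟨hs, h⟩)
      exact ⟨p, Finset.mem_union_left _ hp, hps⟩
    · obtain ⟨p, hp, hps⟩ := hQ s (Finset.mem_filter.2 ⟨hs, h⟩)
      exact ⟨p, Finset.mem_union_right _ hp, hps⟩
  · obtain ⟨P, hP, hPc⟩ := tau_exists_aux F hF
    rw [← hPc, ← Finset.card_filter_add_card_filter_not (s := P) (fun p => p ∈ R)]
    apply add_le_add
    · apply tau_le_aux
      intro s hs
      obtain ⟨hs, h⟩ := Finset.mem_filter.1 hs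
      obtain ⟨p, hp, hps⟩ := hP s hs
      exact ⟨p, Finset.mem_filter.2 ⟨hp, h hps⟩, hps⟩
    · apply tau_le_aux
      intro s hs
      obtain ⟨hs, h⟩ := Finset.mem_filter.1 hs
      obtain ⟨p, hp, hps⟩ := hP s hs
      have hd := (hR s hs).resolve_left h
      exact ⟨p, Finset.mem_filter.2 ⟨hp, Set.disjoint_left.1 hd hps⟩, hps⟩

noncomputable def avoidFam (F : Finset (Set (ℝ × ℝ))) (W : Finset (ℝ × ℝ)) :
    Finset (Set (ℝ × ℝ)) := F.filter (fun s => ∀ w ∈ W, w ∉ s)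

theorem mem_avoidFam {F : Finset (Set (ℝ × ℝ))} {W : Finset (ℝ × ℝ)} {s : Set (ℝ × ℝ)} :
    s ∈ avoidFam F W ↔ s ∈ F ∧ ∀ w ∈ W, w ∉ s := by
  simp [avoidFam]

theorem tau_split_aux (F : Finset (Set (ℝ × ℝ))) (hF : ∀ s ∈ F, s.Nonempty) (R : Set (ℝ × ℝ))
    (hR : ∀ s ∈ F, s ⊆ R ∨ Disjoint s R) (W₁ W₂ : Finset (ℝ × ℝ))
    (h₁ : ∀ w ∈ W₁, w ∈ R) (h₂ : ∀ w ∈ W₂, w ∉ R)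
    (e₁ : tau (avoidFam F W₁) = tau F) (e₂ : tau (avoidFam F W₂) = tau F) :
    tau (avoidFam F (W₁ ∪ W₂)) = tau F := by
  have key : ∀ W, tau (avoidFam F W) = tau ((avoidFam F W).filter (fun s => s ⊆ R)) +
      tau ((avoidFam F W).filter (fun s => ¬ s ⊆ R)) := fun W =>
    tau_add_aux _ (fun s hs => hF s (mem_avoidFam.1 hs).1) R
      (fun s hs => hR s (mem_avoidFam.1 hs).1)
  have k0 := tau_add_aux F hF R hR
  have a₁ : (avoidFam F W₁).filter (fun s => ¬ s ⊆ R) = F.filter (fun s => ¬ s ⊆ R) := by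
    ext s
    simp only [Finset.mem_filter, mem_avoidFam]
    refine ⟨fun h => ⟨h.1.1, h.2⟩, fun h => ⟨⟨h.1, fun w hw hws => ?_⟩, h.2⟩⟩
    exact Set.disjoint_left.1 ((hR s h.1).resolve_left h.2) hws (h₁ w hw)
  have a₂ : (avoidFam F W₂).filter (fun s => s ⊆ R) = F.filter (fun s => s ⊆ R) := by
    ext s
    simp only [Finset.mem_filter, mem_avoidFam]
    refine ⟨fun h => ⟨h.1.1, h.2⟩, fun h => ⟨⟨h.1, fun w hw hws => ?_⟩, h.2⟩⟩
    exact h₂ w hw (h.2 hws)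
  have a₃ : (avoidFam F (W₁ ∪ W₂)).filter (fun s => s ⊆ R) =
      (avoidFam F W₁).filter (fun s => s ⊆ R) := by
    ext s
    simp only [Finset.mem_filter, mem_avoidFam, Finset.mem_union]
    refine ⟨fun h => ⟨⟨h.1.1, fun w hw => h.1.2 w (Or.inl hw)⟩, h.2⟩,
      fun h => ⟨⟨h.1.1, fun w hw hws => ?_⟩, h.2⟩⟩
    rcases hw with hw | hw
    · exact h.1.2 w hw hws
    · exact h₂ w hw (h.2 hws)
  have a₄ : (avoidFam F (W₁ ∪ W₂)).filter (fun s => ¬ s ⊆ R) =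
      (avoidFam F W₂).filter (fun s => ¬ s ⊆ R) := by
    ext s
    simp only [Finset.mem_filter, mem_avoidFam, Finset.mem_union]
    refine ⟨fun h => ⟨⟨h.1.1, fun w hw => h.1.2 w (Or.inr hw)⟩, h.2⟩,
      fun h => ⟨⟨h.1.1, fun w hw hws => ?_⟩, h.2⟩⟩
    rcases hw with hw | hw
    · exact Set.disjoint_left.1 ((hR s h.1.1).resolve_left h.2) hws (h₁ w hw)
    · exact h.1.2 w hw hws
  have k1 := key W₁
  have k2 := key W₂
  have k3 := key (W₁ ∪ W₂)
  rw [a₁] at k1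
  rw [a₂] at k2
  rw [a₃, a₄] at k3
  omega

/-- Row-major strict order. -/
def rowLt (p q : ℝ × ℝ) : Prop := p.2 < q.2 ∨ (p.2 = q.2 ∧ p.1 < q.1)

theorem rowLt_tri (p q : ℝ × ℝ) : rowLt p q ∨ p = q ∨ rowLt q p := by
  rcases p with ⟨a, b⟩
  rcases q with ⟨c, d⟩
  simp only [rowLt, Prod.mk.injEq]
  rcases lt_trichotomy b d with h | h | h <;> rcases lt_trichotomy a c with h' | h' | h' <;>
    simp [h, h']

theorem rowLt_asymm {p q : ℝ × ℝ} (h : rowLt p q) (h' : rowLt q p) : False := by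
  rcases h with h | ⟨h, h1⟩ <;> rcases h' with h' | ⟨h', h2⟩ <;> linarith

theorem exists_mid_aux (W : Finset (ℝ × ℝ)) (h : 2 < W.card) :
    ∃ a ∈ W, ∃ m ∈ W, ∃ b ∈ W, rowLt a m ∧ rowLt m b := by
  let key : ℝ × ℝ → ℝ ×ₗ ℝ := fun p => toLex (p.2, p.1)
  have hk : ∀ p q, key p ≤ key q → p ≠ q → rowLt p q := by
    intro p q hpq hne
    rw [Prod.Lex.toLex_le_toLex] at hpq
    rcases hpq with h | h
    · exact Or.inl h
    · exact Or.inr ⟨h.1, lt_of_le_of_ne h.2 (fun h' => hne (Prod.ext h' h.1))⟩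
  have hne : W.Nonempty := Finset.card_pos.1 (by omega)
  obtain ⟨a, ha, hamin⟩ := Finset.exists_min_image W key hne
  obtain ⟨b, hb, hbmax⟩ := Finset.exists_max_image W key hne
  have : ((W.erase a).erase b).Nonempty := by
    apply Finset.card_pos.1
    have h1 := Finset.pred_card_le_card_erase (s := W) (a := a)
    have h2 := Finset.pred_card_le_card_erase (s := W.erase a) (a := b)
    omega
  obtain ⟨m, hm⟩ := this
  simp only [Finset.mem_erase] at hm
  exact ⟨a, ha, m, hm.2.2, b, hb, hk _ _ (hamin m hm.2.2) hm.2.1.symm,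
    hk _ _ (hbmax m hm.2.2) hm.1⟩

theorem avoid_all_aux (H : Finset (Set (ℝ × ℝ)))
    (hH : ∀ s ∈ H, ∃ a b c : ℝ, a ≤ b ∧ s = {p : ℝ × ℝ | p.2 = c ∧ a ≤ p.1 ∧ p.1 ≤ b})
    (W : Finset (ℝ × ℝ))
    (h1 : ∀ p ∈ W, tau (avoidFam H {p}) = tau H)
    (h2 : ∀ p ∈ W, ∀ q ∈ W, p ≠ q → p.2 = q.2 → tau (avoidFam H {p, q}) = tau H) :
    tau (avoidFam H W) = tau H := by
  have hne : ∀ s ∈ H, s.Nonempty := by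
    intro s hs
    obtain ⟨a, b, c, hab, rfl⟩ := hH s hs
    exact ⟨(a, c), rfl, le_refl _, hab⟩
  have h3 : ∀ p ∈ W, ∀ q ∈ W, p.2 < q.2 → tau (avoidFam H {p, q}) = tau H := by
    intro p hp q hq hpq
    refine tau_split_aux H hne {r | r.2 ≤ p.2} ?_ {p} {q} ?_ ?_ (h1 p hp) (h1 q hq)
    · intro s hs
      obtain ⟨a, b, c, hab, rfl⟩ := hH s hs
      by_cases hc : c ≤ p.2
      · left
        rintro r ⟨hr, -⟩
        simpa [hr] using hc
      · right
        rw [Set.disjoint_left]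
        rintro r ⟨hr, -⟩ hr'
        exact hc (hr ▸ hr')
    · simp
    · simpa using hpq
  induction W using Finset.strongInduction with
  | H W ih =>
    by_cases hc : 2 < W.card
    · obtain ⟨a, ha, m, hm, b, hb, ham, hmb⟩ := exists_mid_aux W hc
      have sub : ∀ W' ⊂ W, tau (avoidFam H W') = tau H := by
        intro W' hW'
        exact ih W' hW' (fun p hp => h1 p (hW'.1 hp))
          (fun p hp q hq => h2 p (hW'.1 hp) q (hW'.1 hq))
          (fun p hp q hq => h3 p (hW'.1 hp) q (hW'.1 hq))
      have comp : ∀ W', avoidFam (avoidFam H {m}) W' = avoidFam H (insert m W') := by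
        intro W'
        ext s
        simp [mem_avoidFam, and_assoc]
      have s1 : insert m (W.filter (fun w => rowLt w m)) ⊂ W := by
        refine (Finset.ssubset_iff_of_subset ?_).2 ⟨b, hb, ?_⟩
        · intro x hx
          rcases Finset.mem_insert.1 hx with rfl | hx
          · exact hm
          · exact (Finset.mem_filter.1 hx).1
        · intro hx
          rcases Finset.mem_insert.1 hx with rfl | hx
          · exact rowLt_asymm hmb hmb
          · exact rowLt_asymm hmb (Finset.mem_filter.1 hx).2
      have s2 : insert m (W.filter (fun w => rowLt m w)) ⊂ W := by
        refine (Finset.ssubset_iff_of_subset ?_).2 ⟨a, ha, ?_⟩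
        · intro x hx
          rcases Finset.mem_insert.1 hx with rfl | hx
          · exact hm
          · exact (Finset.mem_filter.1 hx).1
        · intro hx
          rcases Finset.mem_insert.1 hx with rfl | hx
          · exact rowLt_asymm ham ham
          · exact rowLt_asymm ham (Finset.mem_filter.1 hx).2
      have e := tau_split_aux (avoidFam H {m}) (fun s hs => hne s (mem_avoidFam.1 hs).1)
        {r | rowLt r m} ?_ (W.filter (fun w => rowLt w m)) (W.filter (fun w => rowLt m w))
        (fun w hw => (Finset.mem_filter.1 hw).2)
        (fun w hw h => rowLt_asymm h (Finset.mem_filter.1 hw).2)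
        (by rw [comp, sub _ s1, h1 m hm]) (by rw [comp, sub _ s2, h1 m hm])
      · rw [comp, h1 m hm] at e
        rw [← e]
        congr 2
        ext w
        simp only [Finset.mem_insert, Finset.mem_union, Finset.mem_filter]
        constructor
        · intro hw
          rcases rowLt_tri w m with h | h | h
          · exact Or.inr (Or.inl ⟨hw, h⟩)
          · exact Or.inl h
          · exact Or.inr (Or.inr ⟨hw, h⟩)
        · rintro (rfl | h | h)
          · exact hm
          · exact h.1
          · exact h.1
      · intro s hs
        obtain ⟨hs, hms⟩ := mem_avoidFam.1 hs
        have hms := hms m (Finset.mem_singleton_self m)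
        obtain ⟨x, y, c, hxy, rfl⟩ := hH s hs
        simp only [Set.mem_ofPred_eq, not_and, not_le] at hms
        by_cases hcase : c < m.2 ∨ (c = m.2 ∧ y < m.1)
        · left
          rintro r ⟨hr, hr1, hr2⟩
          rcases hcase with h | h
          · exact Or.inl (by linarith)
          · exact Or.inr ⟨by linarith [h.1], by linarith [h.2]⟩
        · right
          push Not at hcase
          rw [Set.disjoint_left]
          rintro r ⟨hr, hr1, hr2⟩ (h | h)
          · linarith [hcase.1]
          · have hcm : c = m.2 := by linarith [h.1]
            have h5 := hcase.2 hcm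
            by_cases hx : x ≤ m.1
            · linarith [hms hcm.symm hx]
            · linarith [h.2]
    · have : W.card = 0 ∨ W.card = 1 ∨ W.card = 2 := by omega
      rcases this with h | h | h
      · rw [Finset.card_eq_zero.1 h]
        congr 1
        ext s
        simp [mem_avoidFam]
      · obtain ⟨p, rfl⟩ := Finset.card_eq_one.1 h
        exact h1 p (by simp)
      · obtain ⟨p, q, hpq, rfl⟩ := Finset.card_eq_two.1 h
        rcases lt_trichotomy p.2 q.2 with h | h | h
        · exact h3 p (by simp) q (by simp) h
        · exact h2 p (by simp) q (by simp) hpq h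
        · rw [Finset.pair_comm]
          exact h3 q (by simp) p (by simp) h

/-- If no point on a vertical line of `V`, and no pair of points with equal `y`-coordinates
on two distinct vertical lines of `V`, decreases the minimum number of points needed to hit
the horizontal segments `H`, then every hitting set for `V ∪ H` has size at least
`|V| + τ(H)`. -/
theorem stmt_13 (V H : Finset (Set (ℝ × ℝ)))
    (hV : ∀ L ∈ V, ∃ c : ℝ, L = {p : ℝ × ℝ | p.1 = c})
    (hH : ∀ s ∈ H, ∃ a b c : ℝ, a ≤ b ∧ s = {p : ℝ × ℝ | p.2 = c ∧ a ≤ p.1 ∧ p.1 ≤ b})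
    (ha : ∀ p : ℝ × ℝ, (∃ L ∈ V, p ∈ L) →
      tau (H.filter (fun s => p ∉ s)) = tau H)
    (hb : ∀ p q : ℝ × ℝ, p.2 = q.2 →
      (∃ L ∈ V, ∃ L' ∈ V, L ≠ L' ∧ p ∈ L ∧ q ∈ L') →
      tau (H.filter (fun s => p ∉ s ∧ q ∉ s)) = tau H) :
    ∀ P : Finset (ℝ × ℝ), (∀ s ∈ V ∪ H, ∃ p ∈ P, p ∈ s) →
      V.card + tau H ≤ P.card := by
  intro P hP
  have hf : ∀ L : V, ∃ p ∈ P, p ∈ L.1 := fun L => hP L.1 (Finset.mem_union_left _ L.2)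
  choose f hfP hfL using hf
  have huniq : ∀ L ∈ V, ∀ L' ∈ V, ∀ p, p ∈ L → p ∈ L' → L = L' := by
    intro L hL L' hL' p hp hp'
    obtain ⟨c, rfl⟩ := hV L hL
    obtain ⟨c', rfl⟩ := hV L' hL'
    have e1 : p.1 = c := hp
    have e2 : p.1 = c' := hp'
    rw [← e1, ← e2]
  have hinj : Function.Injective f := by
    intro L L' h
    exact Subtype.ext (huniq L.1 L.2 L'.1 L'.2 (f L) (hfL L) (h ▸ hfL L'))
  let W : Finset (ℝ × ℝ) := Finset.univ.image f
  have hWc : W.card = V.card := by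
    rw [Finset.card_image_of_injective _ hinj]
    simp
  have hWP : W ⊆ P := by
    intro x hx
    obtain ⟨L, -, rfl⟩ := Finset.mem_image.1 hx
    exact hfP L
  have hmain : tau (avoidFam H W) = tau H := by
    apply avoid_all_aux H hH W
    · intro p hp
      obtain ⟨L, -, rfl⟩ := Finset.mem_image.1 hp
      rw [← ha (f L) ⟨L.1, L.2, hfL L⟩]
      congr 1
      ext s
      simp [mem_avoidFam]
    · intro p hp q hq hpq hy
      obtain ⟨L, -, rfl⟩ := Finset.mem_image.1 hp
      obtain ⟨L', -, rfl⟩ := Finset.mem_image.1 hq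
      rw [← hb (f L) (f L') hy ⟨L.1, L.2, L'.1, L'.2,
        fun h => hpq (congrArg f (Subtype.ext h)), hfL L, hfL L'⟩]
      congr 1
      ext s
      simp [mem_avoidFam]
  have hle : tau (avoidFam H W) ≤ (P \ W).card := by
    apply tau_le_aux
    intro s hs
    obtain ⟨hs, hsW⟩ := mem_avoidFam.1 hs
    obtain ⟨p, hp, hps⟩ := hP s (Finset.mem_union_right _ hs)
    exact ⟨p, Finset.mem_sdiff.2 ⟨hp, fun h => hsW p h hps⟩, hps⟩
  have := Finset.card_sdiff_add_card_eq_card hWP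
  omega
end

section
/- Let S be a finite set of pairwise distinct lines in the plane ℝ², each parallel to one of three fixed, pairwise distinct directions, with x ≥ y ≥ z ≥ 0 lines in the three respective directions. Call a point of ℝ² a triple point of S if it lies on three lines of S, and call a finite set T of triple points independent if no two distinct points of T lie on a common line of S. Let K be the maximum cardinality of an independent set of triple points of S (so K ≤ z). Then τ(S) = K + OPT₂(x−K, y−K, z−K). -/
open scoped Classical

lemma line_unique (d : ℝ × ℝ) (S : Finset (Set (ℝ × ℝ)))
    (hS : ∀ L ∈ S, ∃ a : ℝ × ℝ, L = {p : ℝ × ℝ | ∃ t : ℝ, p = a + t • d})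
    (L M : Set (ℝ × ℝ)) (hL : L ∈ S) (hM : M ∈ S) (p : ℝ × ℝ) (hpL : p ∈ L) (hpM : p ∈ M) :
    L = M := by
  have key : ∀ N ∈ S, p ∈ N → N = {q : ℝ × ℝ | ∃ t : ℝ, q = p + t • d} := by
    intro N hN hp
    obtain ⟨a, rfl⟩ := hS N hN
    obtain ⟨s, rfl⟩ := hp
    ext q
    constructor
    · rintro ⟨t, rfl⟩
      exact ⟨t - s, by rw [sub_smul]; abel⟩
    · rintro ⟨t, rfl⟩
      exact ⟨s + t, by rw [add_smul]; abel⟩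
  rw [key L hL hpL, key M hM hpM]

lemma lines_meet (d e : ℝ × ℝ) (hd : d ≠ 0) (h : ∀ c : ℝ, e ≠ c • d) (S T : Finset (Set (ℝ × ℝ)))
    (hS : ∀ L ∈ S, ∃ a : ℝ × ℝ, L = {p : ℝ × ℝ | ∃ t : ℝ, p = a + t • d})
    (hT : ∀ L ∈ T, ∃ a : ℝ × ℝ, L = {p : ℝ × ℝ | ∃ t : ℝ, p = a + t • e}) :
    ∀ L ∈ S, ∀ M ∈ T, ∃ p, p ∈ L ∧ p ∈ M := by
  intro L hL M hM
  obtain ⟨a, rfl⟩ := hS L hL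
  obtain ⟨b, rfl⟩ := hT M hM
  obtain ⟨d1, d2⟩ := d
  obtain ⟨e1, e2⟩ := e
  obtain ⟨a1, a2⟩ := a
  obtain ⟨b1, b2⟩ := b
  have hdet : d1 * e2 - d2 * e1 ≠ 0 := by
    intro h0
    by_cases h1 : d1 = 0
    · have h2 : d2 ≠ 0 := by
        rintro rfl
        exact hd (by simp [h1])
      subst h1
      have : e1 = 0 := by
        have : d2 * e1 = 0 := by linarith
        simpa [h2] using this
      apply h (e2 / d2)
      ext <;> simp [this, h2]
    · apply h (e1 / d1)
      ext
      · simp [h1]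
      · simp only [Prod.smul_mk, smul_eq_mul]
        field_simp
        linarith
  obtain ⟨D, hD⟩ : ∃ D, D = d1 * e2 - d2 * e1 := ⟨_, rfl⟩
  rw [← hD] at hdet
  have ht : (a1, a2) + (((b1 - a1) * e2 - (b2 - a2) * e1) / D) • (d1, d2)
      = (b1, b2) + (((b1 - a1) * d2 - (b2 - a2) * d1) / D) • (e1, e2) := by
    ext
    · simp only [Prod.smul_mk, smul_eq_mul, Prod.mk_add_mk]
      field_simp
      linear_combination (a1 - b1) * hD
    · simp only [Prod.smul_mk, smul_eq_mul, Prod.mk_add_mk]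
      field_simp
      linear_combination (a2 - b2) * hD
  exact ⟨_, ⟨_, rfl⟩, ⟨_, ht⟩⟩

lemma cover_pairs (n : ℕ) : ∀ A B C : Finset (Set (ℝ × ℝ)),
    (∀ L ∈ A, ∃ p, p ∈ L) → (∀ L ∈ B, ∃ p, p ∈ L) → (∀ L ∈ C, ∃ p, p ∈ L) →
    (∀ L ∈ A, ∀ M ∈ B, ∃ p, p ∈ L ∧ p ∈ M) →
    (∀ L ∈ A, ∀ M ∈ C, ∃ p, p ∈ L ∧ p ∈ M) →
    (∀ L ∈ B, ∀ M ∈ C, ∃ p, p ∈ L ∧ p ∈ M) →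
    A.card ≤ n → B.card ≤ n → C.card ≤ n → A.card + B.card + C.card ≤ 2 * n →
    ∃ Hs : Finset (ℝ × ℝ), Hs.card ≤ n ∧ (∀ L ∈ A, ∃ p ∈ Hs, p ∈ L) ∧
      (∀ L ∈ B, ∃ p ∈ Hs, p ∈ L) ∧ (∀ L ∈ C, ∃ p ∈ Hs, p ∈ L) := by
  induction n with
  | zero =>
    intro A B C _ _ _ _ _ _ h1 h2 h3 _
    have h1 : A = ∅ := by simpa using h1
    have h2 : B = ∅ := by simpa using h2
    have h3 : C = ∅ := by simpa using h3
    subst h1 h2 h3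
    exact ⟨∅, by simp⟩
  | succ n ih =>
    have step : ∀ A B C : Finset (Set (ℝ × ℝ)), C.card ≤ A.card → C.card ≤ B.card →
        (∀ L ∈ A, ∃ p, p ∈ L) → (∀ L ∈ B, ∃ p, p ∈ L) → (∀ L ∈ C, ∃ p, p ∈ L) →
        (∀ L ∈ A, ∀ M ∈ B, ∃ p, p ∈ L ∧ p ∈ M) →
        (∀ L ∈ A, ∀ M ∈ C, ∃ p, p ∈ L ∧ p ∈ M) →
        (∀ L ∈ B, ∀ M ∈ C, ∃ p, p ∈ L ∧ p ∈ M) →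
        A.card ≤ n + 1 → B.card ≤ n + 1 → C.card ≤ n + 1 →
        A.card + B.card + C.card ≤ 2 * (n + 1) →
        ∃ Hs : Finset (ℝ × ℝ), Hs.card ≤ n + 1 ∧ (∀ L ∈ A, ∃ p ∈ Hs, p ∈ L) ∧
          (∀ L ∈ B, ∃ p ∈ Hs, p ∈ L) ∧ (∀ L ∈ C, ∃ p ∈ Hs, p ∈ L) := by
      intro A B C hCA hCB nA nB nC hAB hAC hBC a b c s
      obtain ⟨p, L, M, hpL, hpM, hAc, hBc⟩ : ∃ (p : ℝ × ℝ) (L M : Set (ℝ × ℝ)),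
          (L ∈ A → p ∈ L) ∧ (M ∈ B → p ∈ M) ∧ (A.erase L).card = A.card - 1 ∧
          (B.erase M).card = B.card - 1 := by
        rcases A.eq_empty_or_nonempty with hA | ⟨L, hL⟩ <;>
        rcases B.eq_empty_or_nonempty with hB | ⟨M, hM⟩
        · subst hA hB
          exact ⟨0, ∅, ∅, by simp⟩
        · obtain ⟨p, hp⟩ := nB M hM
          subst hA
          exact ⟨p, ∅, M, by simp, fun _ => hp, by simp, Finset.card_erase_of_mem hM⟩
        · obtain ⟨p, hp⟩ := nA L hL
          subst hB
          exact ⟨p, L, ∅, fun _ => hp, by simp, Finset.card_erase_of_mem hL, by simp⟩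
        · obtain ⟨p, hp, hp'⟩ := hAB L hL M hM
          exact ⟨p, L, M, fun _ => hp, fun _ => hp', Finset.card_erase_of_mem hL,
            Finset.card_erase_of_mem hM⟩
      have sA : ∀ N ∈ A.erase L, N ∈ A := fun N hN => Finset.mem_of_mem_erase hN
      have sB : ∀ N ∈ B.erase M, N ∈ B := fun N hN => Finset.mem_of_mem_erase hN
      obtain ⟨Hs, hc, h1, h2, h3⟩ := ih (A.erase L) (B.erase M) C
        (fun N hN => nA N (sA N hN)) (fun N hN => nB N (sB N hN)) nC
        (fun N hN N' hN' => hAB N (sA N hN) N' (sB N' hN'))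
        (fun N hN => hAC N (sA N hN)) (fun N hN => hBC N (sB N hN))
        (by omega) (by omega) (by omega) (by omega)
      refine ⟨insert p Hs, (Finset.card_insert_le _ _).trans (by omega), ?_, ?_, ?_⟩
      · intro N hN
        by_cases hNL : N = L
        · exact ⟨p, by simp, hNL ▸ hpL (hNL ▸ hN)⟩
        · obtain ⟨q, hq, hq'⟩ := h1 N (Finset.mem_erase.2 ⟨hNL, hN⟩)
          exact ⟨q, Finset.mem_insert_of_mem hq, hq'⟩
      · intro N hN
        by_cases hNL : N = M
        · exact ⟨p, by simp, hNL ▸ hpM (hNL ▸ hN)⟩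
        · obtain ⟨q, hq, hq'⟩ := h2 N (Finset.mem_erase.2 ⟨hNL, hN⟩)
          exact ⟨q, Finset.mem_insert_of_mem hq, hq'⟩
      · intro N hN
        obtain ⟨q, hq, hq'⟩ := h3 N hN
        exact ⟨q, Finset.mem_insert_of_mem hq, hq'⟩
    intro A B C nA nB nC hAB hAC hBC a b c s
    have sw : ∀ {A B : Finset (Set (ℝ × ℝ))}, (∀ L ∈ A, ∀ M ∈ B, ∃ p, p ∈ L ∧ p ∈ M) →
        (∀ L ∈ B, ∀ M ∈ A, ∃ p, p ∈ L ∧ p ∈ M) := by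
      intro A B h L hL M hM
      obtain ⟨p, h1, h2⟩ := h M hM L hL
      exact ⟨p, h2, h1⟩
    by_cases c1 : C.card ≤ A.card ∧ C.card ≤ B.card
    · exact step A B C c1.1 c1.2 nA nB nC hAB hAC hBC a b c s
    by_cases c2 : B.card ≤ A.card ∧ B.card ≤ C.card
    · obtain ⟨Hs, h0, h1, h2, h3⟩ :=
        step A C B c2.1 c2.2 nA nC nB hAC hAB (sw hBC) a c b (by omega)
      exact ⟨Hs, h0, h1, h3, h2⟩
    · obtain ⟨Hs, h0, h1, h2, h3⟩ :=
        step B C A (by omega) (by omega) nB nC nA hBC (sw hAB) (sw hAC) b c a (by omega)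
      exact ⟨Hs, h0, h3, h1, h2⟩

lemma remove_lines (S : Finset (Set (ℝ × ℝ))) (T : Finset (ℝ × ℝ))
    (h1 : ∀ p ∈ T, ∃ L ∈ S, p ∈ L)
    (h2 : ∀ p ∈ T, ∀ q ∈ T, p ≠ q → ∀ L ∈ S, ¬(p ∈ L ∧ q ∈ L)) :
    T.card ≤ S.card ∧ ∃ A ⊆ S, A.card = S.card - T.card ∧
      ∀ L ∈ S, L ∉ A → ∃ p ∈ T, p ∈ L := by
  choose! g hg hg' using h1
  have hinj : Set.InjOn g T := by
    intro p hp q hq hpq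
    by_contra hne
    exact h2 p hp q hq hne (g p) (hg p hp) ⟨hg' p hp, hpq ▸ hg' q hq⟩
  have hsub : T.image g ⊆ S := by
    intro L hL
    obtain ⟨p, hp, rfl⟩ := Finset.mem_image.1 hL
    exact hg p hp
  have hc : (T.image g).card = T.card := Finset.card_image_of_injOn hinj
  refine ⟨hc ▸ Finset.card_le_card hsub, S \ T.image g, Finset.sdiff_subset, ?_, ?_⟩
  · rw [Finset.card_sdiff_of_subset hsub, hc]
  · intro L hL hL'
    have : L ∈ T.image g := by
      by_contra h
      exact hL' (Finset.mem_sdiff.2 ⟨hL, h⟩)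
    obtain ⟨p, hp, rfl⟩ := Finset.mem_image.1 this
    exact ⟨p, hp, hg' p hp⟩

/-- For lines of three distinct slopes, if `K` is the maximum cardinality of an
independent set of triple points, then `τ(S) = K + OPT2 (x−K) (y−K) (z−K)`. -/
theorem stmt_14 (d₁ d₂ d₃ : ℝ × ℝ) (hd₁ : d₁ ≠ 0) (hd₂ : d₂ ≠ 0) (hd₃ : d₃ ≠ 0)
    (h12 : ∀ c : ℝ, d₂ ≠ c • d₁) (h13 : ∀ c : ℝ, d₃ ≠ c • d₁) (h23 : ∀ c : ℝ, d₃ ≠ c • d₂)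
    (S₁ S₂ S₃ : Finset (Set (ℝ × ℝ)))
    (hS₁ : ∀ L ∈ S₁, ∃ a : ℝ × ℝ, L = {p : ℝ × ℝ | ∃ t : ℝ, p = a + t • d₁})
    (hS₂ : ∀ L ∈ S₂, ∃ a : ℝ × ℝ, L = {p : ℝ × ℝ | ∃ t : ℝ, p = a + t • d₂})
    (hS₃ : ∀ L ∈ S₃, ∃ a : ℝ × ℝ, L = {p : ℝ × ℝ | ∃ t : ℝ, p = a + t • d₃})
    (h12' : Disjoint S₁ S₂) (h13' : Disjoint S₁ S₃) (h23' : Disjoint S₂ S₃)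
    (x y z : ℕ) (hx : S₁.card = x) (hy : S₂.card = y) (hz : S₃.card = z)
    (hxy : y ≤ x) (hyz : z ≤ y)
    (K : ℕ)
    (hK : IsGreatest {n : ℕ | ∃ T : Finset (ℝ × ℝ),
      (∀ p ∈ T, 3 ≤ ((S₁ ∪ S₂ ∪ S₃).filter (fun L => p ∈ L)).card) ∧
      (∀ p ∈ T, ∀ q ∈ T, p ≠ q → ∀ L ∈ S₁ ∪ S₂ ∪ S₃, ¬(p ∈ L ∧ q ∈ L)) ∧
      T.card = n} K) :
    IsLeast {n : ℕ | ∃ Hs : Finset (ℝ × ℝ),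
      (∀ L ∈ S₁ ∪ S₂ ∪ S₃, ∃ p ∈ Hs, p ∈ L) ∧ Hs.card = n}
      (K + OPT2 (x - K) (y - K) (z - K)) := by
  have u1 := line_unique d₁ S₁ hS₁
  have u2 := line_unique d₂ S₂ hS₂
  have u3 := line_unique d₃ S₃ hS₃
  have m12 := lines_meet d₁ d₂ hd₁ h12 S₁ S₂ hS₁ hS₂
  have m13 := lines_meet d₁ d₃ hd₁ h13 S₁ S₃ hS₁ hS₃
  have m23 := lines_meet d₂ d₃ hd₂ h23 S₂ S₃ hS₂ hS₃
  have f1 : ∀ p, (S₁.filter (fun L => p ∈ L)).card ≤ 1 := fun p => Finset.card_le_one.2 (by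
    intro L hL M hM
    rw [Finset.mem_filter] at hL hM
    exact u1 L M hL.1 hM.1 p hL.2 hM.2)
  have f2 : ∀ p, (S₂.filter (fun L => p ∈ L)).card ≤ 1 := fun p => Finset.card_le_one.2 (by
    intro L hL M hM
    rw [Finset.mem_filter] at hL hM
    exact u2 L M hL.1 hM.1 p hL.2 hM.2)
  have f3 : ∀ p, (S₃.filter (fun L => p ∈ L)).card ≤ 1 := fun p => Finset.card_le_one.2 (by
    intro L hL M hM
    rw [Finset.mem_filter] at hL hM
    exact u3 L M hL.1 hM.1 p hL.2 hM.2)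
  have fs : ∀ p, ((S₁ ∪ S₂ ∪ S₃).filter (fun L => p ∈ L)).card ≤
      (S₁.filter (fun L => p ∈ L)).card + (S₂.filter (fun L => p ∈ L)).card +
      (S₃.filter (fun L => p ∈ L)).card := by
    intro p
    rw [Finset.filter_union, Finset.filter_union]
    refine (Finset.card_union_le _ _).trans ?_
    gcongr
    exact Finset.card_union_le _ _
  have hcard : (S₁ ∪ S₂ ∪ S₃).card = x + y + z := by
    rw [Finset.card_union_of_disjoint (Finset.disjoint_union_left.2 ⟨h13', h23'⟩),
      Finset.card_union_of_disjoint h12', hx, hy, hz]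
  obtain ⟨⟨T, hT3, hTi, hTc⟩, hmax⟩ := hK
  have pos : ∀ (S : Finset (Set (ℝ × ℝ))) (p : ℝ × ℝ),
      1 ≤ (S.filter (fun L => p ∈ L)).card → ∃ L ∈ S, p ∈ L := by
    intro S p h
    obtain ⟨L, hL⟩ := Finset.card_pos.1 h
    rw [Finset.mem_filter] at hL
    exact ⟨L, hL⟩
  obtain ⟨k1, A, hA, cA, rA⟩ := remove_lines S₁ T
    (fun p hp => pos S₁ p (by have := hT3 p hp; have := fs p; have := f2 p; have := f3 p; omega))
    (fun p hp q hq h L hL => hTi p hp q hq h L (by simp [hL]))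
  obtain ⟨k2, B, hB, cB, rB⟩ := remove_lines S₂ T
    (fun p hp => pos S₂ p (by have := hT3 p hp; have := fs p; have := f1 p; have := f3 p; omega))
    (fun p hp q hq h L hL => hTi p hp q hq h L (by simp [hL]))
  obtain ⟨k3, C, hC, cC, rC⟩ := remove_lines S₃ T
    (fun p hp => pos S₃ p (by have := hT3 p hp; have := fs p; have := f2 p; have := f1 p; omega))
    (fun p hp q hq h L hL => hTi p hp q hq h L (by simp [hL]))
  have lower : ∀ Hs : Finset (ℝ × ℝ), (∀ L ∈ S₁ ∪ S₂ ∪ S₃, ∃ p ∈ Hs, p ∈ L) →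
      K + OPT2 (x - K) (y - K) (z - K) ≤ Hs.card := by
    intro Hs hH
    choose! f hf hf' using hH
    have hxle : x ≤ Hs.card := by
      rw [← hx]
      refine Finset.card_le_card_of_injOn f (fun L hL => hf L (by simp [Finset.mem_coe.1 hL])) ?_
      intro L hL M hM hLM
      have hL' : L ∈ S₁ := hL
      have hM' : M ∈ S₁ := hM
      exact u1 L M hL' hM' (f L) (hf' L (by simp [hL'])) (hLM ▸ hf' M (by simp [hM']))
    have hle3 : ∀ p, ((S₁ ∪ S₂ ∪ S₃).filter (fun L => p ∈ L)).card ≤ 3 := by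
      intro p
      have := fs p; have := f1 p; have := f2 p; have := f3 p; omega
    have hsub : ∀ p, (S₁ ∪ S₂ ∪ S₃).filter (fun L => f L = p) ⊆
        (S₁ ∪ S₂ ∪ S₃).filter (fun L => p ∈ L) := by
      intro p L hL
      rw [Finset.mem_filter] at hL ⊢
      exact ⟨hL.1, hL.2 ▸ hf' L hL.1⟩
    have hsum := Finset.card_eq_sum_card_fiberwise (f := f) (s := S₁ ∪ S₂ ∪ S₃) (t := Hs)
      (fun L hL => hf L hL)
    set U := Hs.filter (fun p => 3 ≤ ((S₁ ∪ S₂ ∪ S₃).filter (fun L => f L = p)).card) with hU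
    have hUK : U.card ≤ K := by
      apply hmax
      refine ⟨U, ?_, ?_, rfl⟩
      · intro p hp
        exact (Finset.mem_filter.1 hp).2.trans (Finset.card_le_card (hsub p))
      · have key : ∀ p ∈ U, ∀ L ∈ S₁ ∪ S₂ ∪ S₃, p ∈ L → f L = p := by
          intro p hp L hL hpL
          have heq := Finset.eq_of_subset_of_card_le (hsub p)
            ((hle3 p).trans (Finset.mem_filter.1 hp).2)
          have : L ∈ (S₁ ∪ S₂ ∪ S₃).filter (fun L => p ∈ L) := Finset.mem_filter.2 ⟨hL, hpL⟩
          rw [← heq] at this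
          exact (Finset.mem_filter.1 this).2
        rintro p hp q hq hpq L hL ⟨h1, h2⟩
        exact hpq ((key p hp L hL h1).symm.trans (key q hq L hL h2))
    have hbound : x + y + z ≤ 2 * Hs.card + U.card := by
      rw [← hcard, hsum, hU, Finset.card_filter, mul_comm, ← smul_eq_mul, ← Finset.sum_const,
        ← Finset.sum_add_distrib]
      apply Finset.sum_le_sum
      intro p _
      have h3 := (Finset.card_le_card (hsub p)).trans (hle3 p)
      split_ifs <;> omega
    unfold OPT2
    split_ifs <;> omega
  have ne1 : ∀ L ∈ S₁, ∃ p, p ∈ L := by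
    intro L hL
    obtain ⟨a, rfl⟩ := hS₁ L hL
    exact ⟨a, 0, by simp⟩
  have ne2 : ∀ L ∈ S₂, ∃ p, p ∈ L := by
    intro L hL
    obtain ⟨a, rfl⟩ := hS₂ L hL
    exact ⟨a, 0, by simp⟩
  have ne3 : ∀ L ∈ S₃, ∃ p, p ∈ L := by
    intro L hL
    obtain ⟨a, rfl⟩ := hS₃ L hL
    exact ⟨a, 0, by simp⟩
  have hopt : x - K ≤ OPT2 (x - K) (y - K) (z - K) ∧
      (x - K) + (y - K) + (z - K) ≤ 2 * OPT2 (x - K) (y - K) (z - K) := by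
    unfold OPT2
    split_ifs <;> omega
  obtain ⟨Hs, hc, g1, g2, g3⟩ := cover_pairs (OPT2 (x - K) (y - K) (z - K)) A B C
    (fun L hL => ne1 L (hA hL)) (fun L hL => ne2 L (hB hL)) (fun L hL => ne3 L (hC hL))
    (fun L hL M hM => m12 L (hA hL) M (hB hM)) (fun L hL M hM => m13 L (hA hL) M (hC hM))
    (fun L hL M hM => m23 L (hB hL) M (hC hM))
    (by omega) (by omega) (by omega) (by omega)
  have comb : ∀ (S D : Finset (Set (ℝ × ℝ))), (∀ L ∈ S, L ∉ D → ∃ p ∈ T, p ∈ L) →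
      (∀ L ∈ D, ∃ p ∈ Hs, p ∈ L) → ∀ L ∈ S, ∃ p ∈ T ∪ Hs, p ∈ L := by
    intro S D h1 h2 L hL
    by_cases hD : L ∈ D
    · obtain ⟨p, hp, hp'⟩ := h2 L hD
      exact ⟨p, Finset.mem_union_right _ hp, hp'⟩
    · obtain ⟨p, hp, hp'⟩ := h1 L hL hD
      exact ⟨p, Finset.mem_union_left _ hp, hp'⟩
  have hhit : ∀ L ∈ S₁ ∪ S₂ ∪ S₃, ∃ p ∈ T ∪ Hs, p ∈ L := by
    intro L hL
    rcases Finset.mem_union.1 hL with hL | hL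
    · rcases Finset.mem_union.1 hL with hL | hL
      · exact comb S₁ A rA g1 L hL
      · exact comb S₂ B rB g2 L hL
    · exact comb S₃ C rC g3 L hL
  refine ⟨⟨T ∪ Hs, hhit, le_antisymm ?_ (lower _ hhit)⟩, ?_⟩
  · exact (Finset.card_union_le _ _).trans (by omega)
  · rintro n ⟨Hs', h, rfl⟩
    exact lower Hs' h
end
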